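/- Let q ≡ 1 (mod 5), let ψ ∈ F_q^*, let χ be a multiplicative character of F_q^* of order 5, and let (s_1,…,s_5) be a 5-tuple of integers. Then N_{(s_1,…,s_5),χ}(q) = (1/(q−1)) Σ_η q^{3−z−δ} · ( Π_{j=1}^5 G(φ,χ^j η) ) / ( Π_{j=1}^5 G(φ,χ^{s_j}η) ) · η(1/ψ^5), where the sum runs over all multiplicative characters η of F_q^*, z is the number of indices j with χ^{s_j}η trivial, and δ = 0 if z ≥ 1 and δ = 1 if z = 0. -/

import Mathlib

/-- The group of multiplicative characters of a finite field with values in `ℂ` is finite. -/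
noncomputable instance {F : Type*} [Field F] [Fintype F] : Fintype (MulChar F ℂ) :=
  Fintype.ofFinite _

/-- The Gauss sum `G(φ, χ) = ∑_{x ∈ F*} φ(x) χ(x)`. -/
noncomputable def gaussSum' {F : Type*} [Field F] [Fintype F]
    (φ : AddChar F ℂ) (χ : MulChar F ℂ) : ℂ :=
  letI := Classical.decEq F
  ∑ x : Fˣ, φ (x : F) * χ (x : F)

/-- `z` is the number of indices `j` such that `χ^{s_j} η` is trivial. -/
noncomputable def zNum {F : Type*} [Field F] [Fintype F]
    (χ η : MulChar F ℂ) (s : Fin 5 → ℤ) : ℕ :=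
  letI := Classical.decEq (MulChar F ℂ)
  (Finset.univ.filter (fun j : Fin 5 => χ ^ s j * η = 1)).card

/-- `δ = 0` if `z ≥ 1` and `δ = 1` if `z = 0`. -/
noncomputable def deltaNum {F : Type*} [Field F] [Fintype F]
    (χ η : MulChar F ℂ) (s : Fin 5 → ℤ) : ℕ :=
  if 1 ≤ zNum χ η s then 0 else 1

/-- `N_{(s₁,…,s₅),χ}(q) = (1/(q-1)) ∑_η q^{5-z-δ} G(φ,η⁵) / (∏_j G(φ,χ^{s_j} η)) η(1/(5ψ)⁵)`. -/
noncomputable def Ntuple {F : Type*} [Field F] [Fintype F]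
    (φ : AddChar F ℂ) (χ : MulChar F ℂ) (ψ : F) (s : Fin 5 → ℤ) : ℂ :=
  (1 / ((Fintype.card F : ℂ) - 1)) *
    ∑ η : MulChar F ℂ,
      (Fintype.card F : ℂ) ^ ((5 : ℤ) - zNum χ η s - deltaNum χ η s) *
        gaussSum' φ (η ^ 5) / (∏ j : Fin 5, gaussSum' φ (χ ^ s j * η)) *
        η ((((5 : F) * ψ) ^ 5)⁻¹)

section HasseDavenport

open Polynomial Finset IntermediateField

theorem natDegree_minpoly_mul_finrank_adjoin {F K : Type*} [Field F] [Field K] [Finite K]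
    [Algebra F K] (y : K) : (minpoly F y).natDegree * Module.finrank F⟮y⟯ K = Module.finrank F K := by
  rw [← IntermediateField.adjoin.finrank (IsIntegral.of_finite F y), Module.finrank_mul_finrank]

section MonicSums

variable (F : Type*) [Field F] [Finite F]

theorem finite_setOf_monic_natDegree_eq (n : ℕ) :
    {f : F[X] | f.Monic ∧ f.natDegree = n}.Finite :=
  Set.finite_coe_iff.mp <| Finite.of_equiv (Fin n → F)
    ((monicEquivDegreeLT n).trans (degreeLTEquiv F n).toEquiv).symm

/-- The finite set of monic polynomials of degree `n` over a finite field. -/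
noncomputable def monicsOfDegree (n : ℕ) : Finset F[X] :=
  (finite_setOf_monic_natDegree_eq F n).toFinset

variable {F}

@[simp]
theorem mem_monicsOfDegree {n : ℕ} {f : F[X]} :
    f ∈ monicsOfDegree F n ↔ f.Monic ∧ f.natDegree = n := by
  simp [monicsOfDegree]

open Classical in
theorem sum_monicsOfDegree_mul {D : F[X]} (hD : D.Monic) {m N : ℕ} (h : D.natDegree + m = N)
    (u : F[X] → ℂ) :
    ∑ g ∈ monicsOfDegree F m, u (D * g) = ∑ f ∈ monicsOfDegree F N with D ∣ f, u f := by
  refine Finset.sum_bij (fun g _ => D * g) ?_ ?_ ?_ (fun _ _ => rfl)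
  · intro g hg
    rw [mem_monicsOfDegree] at hg
    simp only [mem_filter, mem_monicsOfDegree]
    exact ⟨⟨hD.mul hg.1, by rw [hD.natDegree_mul hg.1, hg.2, h]⟩, dvd_mul_right _ _⟩
  · intro g₁ _ g₂ _ he
    exact mul_left_cancel₀ hD.ne_zero he
  · intro f hf
    simp only [mem_filter, mem_monicsOfDegree] at hf
    obtain ⟨⟨hf, hfn⟩, g, rfl⟩ := hf
    have hg : g.Monic := hD.of_mul_monic_left hf
    refine ⟨g, ?_, rfl⟩
    rw [hD.natDegree_mul hg] at hfn
    rw [mem_monicsOfDegree]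
    exact ⟨hg, by omega⟩

open Classical in
theorem card_filter_minpoly_eq {K : Type*} [Field K] [Fintype K] [Algebra F K] {P : F[X]}
    (hP : P.Monic) (hirr : Irreducible P) :
    #{y : K | minpoly F y = P} =
      if P.natDegree ∣ Module.finrank F K then P.natDegree else 0 := by
  have : Fact (Irreducible P) := ⟨hirr⟩
  have key (y : K) : minpoly F y = P ↔ y ∈ P.rootSet K := by
    rw [mem_rootSet, and_iff_right hP.ne_zero]
    constructor
    · rintro rfl
      exact minpoly.aeval _ _
    · intro h
      exact (minpoly.eq_of_irreducible_of_monic hirr h hP).symm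
  split_ifs with h
  · have hfr : Module.finrank F (AdjoinRoot P) = P.natDegree :=
      finrank_quotient_span_eq_natDegree
    obtain ⟨e⟩ := FiniteField.nonempty_algHom_of_finrank_dvd (F := F) (K := AdjoinRoot P)
      (L := K) (by rwa [hfr])
    have hroot : minpoly F (e (AdjoinRoot.root P)) = P := by
      rw [key, mem_rootSet, and_iff_right hP.ne_zero, aeval_algHom_apply, AdjoinRoot.aeval_eq,
        AdjoinRoot.mk_self, map_zero]
    have hs : (P.map (algebraMap F K)).Splits := by
      rw [← hroot]
      exact Normal.splits inferInstance _
    rw [← card_rootSet_eq_natDegree (PerfectField.separable_of_irreducible hirr) hs,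
      ← Fintype.card_subtype]
    exact Fintype.card_congr (Equiv.subtypeEquivRight key)
  · rw [Finset.card_eq_zero, Finset.filter_eq_empty_iff]
    rintro y - rfl
    exact h (Dvd.intro _ (natDegree_minpoly_mul_finrank_adjoin y))

open Classical in
theorem card_filter_pow_div_natDegree_dvd {F : Type*} [Field F] {f P : F[X]} (hf : f.Monic)
    (hP : Irreducible P) (hn : normalize P = P) :
    #{i ∈ range f.natDegree | P.natDegree ∣ i + 1 ∧ P ^ ((i + 1) / P.natDegree) ∣ f} =
      (UniqueFactorizationMonoid.normalizedFactors f).count P := by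
  have hd := hP.natDegree_pos
  have hle (a : ℕ) : P ^ a ∣ f ↔ a ≤ (UniqueFactorizationMonoid.normalizedFactors f).count P := by
    rw [pow_dvd_iff_le_emultiplicity,
      UniqueFactorizationMonoid.emultiplicity_eq_count_normalizedFactors hP hf.ne_zero, hn]
    norm_cast
  rw [← Finset.card_range ((UniqueFactorizationMonoid.normalizedFactors f).count P)]
  symm
  refine Finset.card_bij (fun a _ => P.natDegree * (a + 1) - 1) ?_ ?_ ?_
  · intro a ha
    have h1 : P.natDegree * (a + 1) - 1 + 1 = P.natDegree * (a + 1) :=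
      Nat.sub_add_cancel (by nlinarith)
    have h2 : P ^ (a + 1) ∣ f := (hle _).mpr (by simpa using ha)
    have h3 := natDegree_le_of_dvd h2 hf.ne_zero
    rw [natDegree_pow] at h3
    simp only [mem_filter, mem_range, h1, Nat.mul_div_cancel_left _ hd]
    exact ⟨by linarith, dvd_mul_right _ _, h2⟩
  · intro a _ b _ h
    have h1 : P.natDegree * (a + 1) - 1 + 1 = P.natDegree * (a + 1) :=
      Nat.sub_add_cancel (by nlinarith)
    have h2 : P.natDegree * (b + 1) - 1 + 1 = P.natDegree * (b + 1) :=
      Nat.sub_add_cancel (by nlinarith)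
    have h3 : P.natDegree * (a + 1) = P.natDegree * (b + 1) := by
      rw [← h1, ← h2]
      exact congrArg (· + 1) h
    simpa using Nat.eq_of_mul_eq_mul_left hd h3
  · intro i hi
    simp only [mem_filter, mem_range] at hi
    obtain ⟨_, ⟨c, hc⟩, hdvd⟩ := hi
    rw [hc, Nat.mul_div_cancel_left _ hd, hle] at hdvd
    have hc0 : c ≠ 0 := by rintro rfl; simp at hc
    refine ⟨c - 1, by rw [mem_range]; omega, ?_⟩
    have : c - 1 + 1 = c := by omega
    simp only [this]
    omega

open Classical in
theorem sum_card_filter_minpoly_pow_dvd (E : ℕ → Type*) [∀ i, Field (E i)] [∀ i, Fintype (E i)]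
    [∀ i, Algebra F (E i)] (hE : ∀ i, Module.finrank F (E i) = i + 1) {f : F[X]}
    (hf : f.Monic) :
    ∑ i ∈ range f.natDegree,
      #{y : E i | minpoly F y ^ Module.finrank F⟮y⟯ (E i) ∣ f} = f.natDegree := by
  set S := (UniqueFactorizationMonoid.normalizedFactors f).toFinset with hS
  have hSP : ∀ P ∈ S, Irreducible P ∧ normalize P = P := fun P hP => by
    rw [hS, Multiset.mem_toFinset] at hP
    exact ⟨UniqueFactorizationMonoid.irreducible_of_normalized_factor P hP,
      UniqueFactorizationMonoid.normalize_normalized_factor P hP⟩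
  have hmonic : ∀ P ∈ S, P.Monic := fun P hP => by
    rw [← (hSP P hP).2]
    exact monic_normalize (hSP P hP).1.ne_zero
  have hfin (i : ℕ) (y : E i) : Module.finrank F⟮y⟯ (E i) = (i + 1) / (minpoly F y).natDegree := by
    refine (Nat.div_eq_of_eq_mul_right ?_ ?_).symm
    · exact minpoly.natDegree_pos (IsIntegral.of_finite F y)
    · rw [natDegree_minpoly_mul_finrank_adjoin, hE]
  have step (i : ℕ) : #{y : E i | minpoly F y ^ Module.finrank F⟮y⟯ (E i) ∣ f} =
      ∑ P ∈ S, if P.natDegree ∣ i + 1 ∧ P ^ ((i + 1) / P.natDegree) ∣ f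
        then P.natDegree else 0 := by
    rw [Finset.card_eq_sum_card_fiberwise (f := fun y => minpoly F y) (t := S)]
    · refine Finset.sum_congr rfl fun P hP => ?_
      have hc := card_filter_minpoly_eq (K := E i) (hmonic P hP) (hSP P hP).1
      rw [hE] at hc
      rw [Finset.filter_filter]
      by_cases hd : P ^ ((i + 1) / P.natDegree) ∣ f
      · simp only [hd, and_true]
        rw [← hc]
        congr 1
        refine Finset.filter_congr fun y _ => ?_
        constructor
        · exact fun h => h.2
        · rintro rfl
          exact ⟨by rwa [hfin], rfl⟩
      · simp only [hd, and_false, if_false, Finset.card_eq_zero, Finset.filter_eq_empty_iff]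
        rintro y - ⟨h, rfl⟩
        rw [hfin] at h
        exact hd h
    · intro y hy
      simp only [coe_filter, mem_univ, true_and, Set.mem_ofPred_eq] at hy
      have h1 : minpoly F y ∣ f :=
        (dvd_pow_self _ (Module.finrank_pos).ne').trans hy
      have h2 : Irreducible (minpoly F y) := minpoly.irreducible (IsIntegral.of_finite F y)
      have h3 : (minpoly F y).Monic := minpoly.monic (IsIntegral.of_finite F y)
      rw [hS, Finset.mem_coe, Multiset.mem_toFinset]
      exact (UniqueFactorizationMonoid.mem_normalizedFactors_iff' hf.ne_zero).mpr
        ⟨h2, h3.normalize_eq_self, h1⟩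
  simp_rw [step]
  rw [Finset.sum_comm]
  have hprod : (UniqueFactorizationMonoid.normalizedFactors f).prod = f := by
    rw [UniqueFactorizationMonoid.prod_normalizedFactors_eq hf.ne_zero, hf.normalize_eq_self]
  calc _ = ∑ P ∈ S, (UniqueFactorizationMonoid.normalizedFactors f).count P * P.natDegree := by
        refine Finset.sum_congr rfl fun P hP => ?_
        rw [← Finset.sum_filter, Finset.sum_const, smul_eq_mul,
          card_filter_pow_div_natDegree_dvd hf (hSP P hP).1 (hSP P hP).2]
    _ = f.natDegree := by
        conv_rhs => rw [← hprod]
        rw [natDegree_multiset_prod_of_monic, Finset.sum_multiset_map_count]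
        · simp [hS]
        · intro P hP
          exact hmonic P (Multiset.mem_toFinset.mpr hP)

/-- Newton's identity for sums of multiplicative functions of monic polynomials. -/
theorem newton_identity_monicsOfDegree (E : ℕ → Type*) [∀ i, Field (E i)] [∀ i, Fintype (E i)]
    [∀ i, Algebra F (E i)] (hE : ∀ i, Module.finrank F (E i) = i + 1) {u : F[X] → ℂ}
    (hu : u 1 = 1) (hmul : ∀ f g : F[X], f.Monic → g.Monic → u (f * g) = u f * u g) (n : ℕ) :
    (n + 1) * ∑ f ∈ monicsOfDegree F (n + 1), u f =
      ∑ i ∈ range (n + 1), (∑ y : E i, u (minpoly F y) ^ Module.finrank F⟮y⟯ (E i)) *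
        ∑ g ∈ monicsOfDegree F (n - i), u g := by
  classical
  have hpow {D : F[X]} (hD : D.Monic) (m : ℕ) : u (D ^ m) = u D ^ m := by
    induction m with
    | zero => simpa using hu
    | succ m ih => rw [pow_succ, hmul _ _ (hD.pow m) hD, ih, pow_succ]
  have step (i : ℕ) (hi : i ∈ range (n + 1)) :
      (∑ y : E i, u (minpoly F y) ^ Module.finrank F⟮y⟯ (E i)) *
        ∑ g ∈ monicsOfDegree F (n - i), u g =
      ∑ f ∈ monicsOfDegree F (n + 1),
        (#{y : E i | minpoly F y ^ Module.finrank F⟮y⟯ (E i) ∣ f} : ℂ) * u f := by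
    have h1 (y : E i) : u (minpoly F y) ^ Module.finrank F⟮y⟯ (E i) *
        ∑ g ∈ monicsOfDegree F (n - i), u g =
        ∑ f ∈ monicsOfDegree F (n + 1),
          if minpoly F y ^ Module.finrank F⟮y⟯ (E i) ∣ f then u f else 0 := by
      have hm : (minpoly F y).Monic := minpoly.monic (IsIntegral.of_finite F y)
      rw [← Finset.sum_filter, ← sum_monicsOfDegree_mul (hm.pow _) (m := n - i), Finset.mul_sum]
      · refine Finset.sum_congr rfl fun g hg => ?_
        rw [hmul _ _ (hm.pow _) (mem_monicsOfDegree.mp hg).1, hpow hm]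
      · rw [natDegree_pow, mul_comm, natDegree_minpoly_mul_finrank_adjoin, hE]
        rw [mem_range] at hi
        omega
    rw [Finset.sum_mul]
    simp_rw [h1]
    rw [Finset.sum_comm]
    refine Finset.sum_congr rfl fun f _ => ?_
    rw [← Finset.sum_filter, Finset.sum_const, nsmul_eq_mul]
  rw [Finset.sum_congr rfl step, Finset.sum_comm, Finset.mul_sum]
  refine Finset.sum_congr rfl fun f hf => ?_
  rw [mem_monicsOfDegree] at hf
  have hc := sum_card_filter_minpoly_pow_dvd E hE hf.1
  rw [hf.2] at hc
  rw [← Finset.sum_mul, ← Nat.cast_sum, hc]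
  push_cast
  rfl

end MonicSums

section PowerSeriesODE

open PowerSeries

theorem PowerSeries.eq_of_derivative_eq_mul {T L M : ℂ⟦X⟧} (hL : d⁄dX ℂ L = T * L)
    (hM : d⁄dX ℂ M = T * M) (h0 : coeff 0 L = coeff 0 M) : L = M := by
  ext n
  induction n using Nat.strong_induction_on with
  | _ n ih =>
    cases n with
    | zero => exact h0
    | succ n =>
      have h1 := congrArg (coeff n) hL
      have h2 := congrArg (coeff n) hM
      rw [coeff_derivative, PowerSeries.coeff_mul] at h1 h2
      have h3 : ∑ p ∈ antidiagonal n, coeff p.1 T * coeff p.2 L =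
          ∑ p ∈ antidiagonal n, coeff p.1 T * coeff p.2 M :=
        Finset.sum_congr rfl fun p hp => by
          rw [ih p.2 (Nat.lt_succ_of_le (by have := mem_antidiagonal.mp hp; omega))]
      have h4 : (n : ℂ) + 1 ≠ 0 := by exact_mod_cast n.succ_ne_zero
      exact mul_right_cancel₀ h4 (h1.trans (h3.trans h2.symm))

theorem PowerSeries.derivative_prod_eq_sum_mul {ι : Type*} (s : Finset ι) {T L : ι → ℂ⟦X⟧}
    (h : ∀ i ∈ s, d⁄dX ℂ (L i) = T i * L i) :
    d⁄dX ℂ (∏ i ∈ s, L i) = (∑ i ∈ s, T i) * ∏ i ∈ s, L i := by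
  classical
  induction s using Finset.induction_on with
  | empty => simp
  | insert a s ha ih =>
    rw [Finset.prod_insert ha, Finset.sum_insert ha, Derivation.leibniz,
      ih fun i hi => h i (Finset.mem_insert_of_mem hi), h a (Finset.mem_insert_self a s)]
    simp only [smul_eq_mul]
    ring

end PowerSeriesODE

section PowerSums

/-- The sum of the fifth powers of the roots of a monic polynomial, expressed by Newton's formulas
in terms of its coefficients. -/
noncomputable def fifthPowerSum {R : Type*} [CommRing R] (f : R[X]) : R :=
  let c := f.reverse.coeff
  5 * c 1 ^ 3 * c 2 - c 1 ^ 5 - 5 * c 1 * c 2 ^ 2 - 5 * c 1 ^ 2 * c 3 + 5 * c 2 * c 3 +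
    5 * c 1 * c 4 - 5 * c 5

theorem fifthPowerSum_mul {R : Type*} [CommRing R] [IsDomain R] {f g : R[X]} (hf : f.Monic)
    (hg : g.Monic) : fifthPowerSum (f * g) = fifthPowerSum f + fifthPowerSum g := by
  have hf0 : f.reverse.coeff 0 = 1 := by simpa using hf.leadingCoeff
  have hg0 : g.reverse.coeff 0 = 1 := by simpa using hg.leadingCoeff
  simp only [fifthPowerSum, reverse_mul_of_domain, Polynomial.coeff_mul,
    Finset.Nat.antidiagonal_succ, Finset.sum_cons, Finset.map_cons,
    Finset.Nat.antidiagonal_zero, Finset.map_singleton, Finset.sum_singleton,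
    Function.Embedding.prodMap, Function.Embedding.coeFn_mk, Prod.map, hf0, hg0,
    Function.Embedding.refl_apply, Nat.succ_eq_add_one, Nat.reduceAdd]
  ring

theorem fifthPowerSum_one {R : Type*} [CommRing R] : fifthPowerSum (1 : R[X]) = 0 := by
  have : (1 : R[X]).reverse = 1 := by simpa using reverse_C (1 : R)
  simp [fifthPowerSum, this, coeff_one]

theorem fifthPowerSum_X_sub_C {R : Type*} [CommRing R] [Nontrivial R] (r : R) :
    fifthPowerSum (X - C r) = r ^ 5 := by
  have h (i : ℕ) : (X - C r).reverse.coeff i = if i = 0 then 1 else if i = 1 then -r else 0 := by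
    rw [coeff_reverse, natDegree_X_sub_C]
    rcases i with _ | _ | i
    · simp [revAt_le, coeff_X]
    · simp [revAt_le, coeff_X]
    · rw [revAt_eq_self_of_lt (by omega)]
      simp [coeff_X]
  simp only [fifthPowerSum, h]
  norm_num
  ring

theorem fifthPowerSum_map {R S : Type*} [CommRing R] [CommRing S] [Nontrivial S] (i : R →+* S)
    {f : R[X]} (hf : f.Monic) : fifthPowerSum (f.map i) = i (fifthPowerSum f) := by
  have h (n : ℕ) : (f.map i).reverse.coeff n = i (f.reverse.coeff n) := by
    rw [coeff_reverse, coeff_reverse, hf.natDegree_map, coeff_map]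
  have h5 : i 5 = 5 := map_ofNat i 5
  simp only [fifthPowerSum, h, map_add, map_sub, map_mul, map_pow, h5]

theorem fifthPowerSum_eq_sum_roots {K : Type*} [Field K] {f : K[X]} (hf : f.Monic)
    (hs : f.Splits) : fifthPowerSum f = (f.roots.map (· ^ 5)).sum := by
  have key (s : Multiset K) :
      fifthPowerSum (s.map fun r => X - C r).prod = (s.map (· ^ 5)).sum := by
    induction s using Multiset.induction_on with
    | empty => simp [fifthPowerSum_one]
    | cons a s ih =>
      rw [Multiset.map_cons, Multiset.prod_cons, fifthPowerSum_mul (monic_X_sub_C a)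
        (monic_multiset_prod_of_monic _ _ fun r _ => monic_X_sub_C r), ih,
        fifthPowerSum_X_sub_C, Multiset.map_cons, Multiset.sum_cons]
  conv_lhs => rw [hs.eq_prod_roots_of_monic hf]
  exact key _

variable {F K : Type*} [Field F] [Finite F] [Field K] [Finite K] [Algebra F K]

theorem trace_pow_five_eq (y : K) :
    Algebra.trace F K (y ^ 5) =
      Module.finrank F⟮y⟯ K • fifthPowerSum (minpoly F y) := by
  have hy : IsIntegral F y := .of_finite F y
  let E := AlgebraicClosure F
  let pb := adjoin.powerBasis hy
  have hgen : pb.gen = AdjoinSimple.gen F y := adjoin.powerBasis_gen hy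
  have hmin : minpoly F pb.gen = minpoly F y := by rw [hgen, minpoly_gen]
  have h1 : Algebra.trace F K (y ^ 5) =
      Module.finrank F⟮y⟯ K • Algebra.trace F F⟮y⟯ (pb.gen ^ 5) := by
    have h : y ^ 5 = algebraMap F⟮y⟯ K (pb.gen ^ 5) := by
      rw [map_pow, hgen, AdjoinSimple.algebraMap_gen]
    rw [h, ← Algebra.trace_trace (S := F⟮y⟯), Algebra.trace_algebraMap, map_nsmul]
  rw [h1]
  congr 1
  apply (algebraMap F E).injective
  classical
  have hsep : (minpoly F y).Separable := Algebra.IsSeparable.isSeparable F y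
  have hmon := minpoly.monic hy
  rw [← fifthPowerSum_map _ hmon, fifthPowerSum_eq_sum_roots (hmon.map _)
    (IsAlgClosed.splits _), trace_eq_sum_embeddings E, ← hmin,
    Fintype.sum_equiv pb.liftEquiv' _ (fun r => (r : E) ^ 5)]
  · rw [Finset.sum_mem_multiset _ _ (fun r : E => r ^ 5) fun _ => rfl,
      Finset.sum_eq_multiset_sum, Multiset.toFinset_val, Multiset.dedup_eq_self.mpr]
    exact nodup_roots ((separable_map _).mpr (hmin ▸ hsep))
  · intro σ
    rw [map_pow, PowerBasis.liftEquiv'_apply_coe]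

end PowerSums

section CyclicGroups

theorem pow_eq_one_iff_mem_range_of_isCyclic {G H : Type*} [CommGroup G] [IsCyclic G] [Finite G]
    [CommGroup H] {ℓ : ℕ} [hℓ : Fact ℓ.Prime] {ρ : G →* H} (hρ : ρ ^ ℓ = 1) (hρ' : ρ ≠ 1) :
    ℓ ∣ Nat.card G ∧ ∀ x, ρ x = 1 ↔ x ∈ (powMonoidHom ℓ : G →* G).range := by
  have hle : (powMonoidHom ℓ : G →* G).range ≤ ρ.ker := by
    rintro _ ⟨y, rfl⟩
    rw [MonoidHom.mem_ker, powMonoidHom_apply, map_pow]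
    exact DFunLike.congr_fun hρ y
  have hne : ρ.ker.index ≠ 1 := by
    rw [Ne, Subgroup.index_eq_one, MonoidHom.ker_eq_top_iff]
    exact hρ'
  have hind := IsCyclic.index_powMonoidHom_range (G := G) ℓ
  have hdvd : ρ.ker.index ∣ ℓ :=
    (Subgroup.index_dvd_of_le hle).trans (hind ▸ Nat.gcd_dvd_right _ _)
  have hker : ρ.ker.index = ℓ := (hℓ.out.eq_one_or_self_of_dvd _ hdvd).resolve_left hne
  have hcard : ℓ ∣ Nat.card G := hker ▸ Subgroup.index_dvd_card _
  have heq : (powMonoidHom ℓ : G →* G).range = ρ.ker := by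
    refine Subgroup.eq_of_le_of_card_ge hle ?_
    have h1 := Subgroup.card_mul_index ρ.ker
    have h2 := Subgroup.card_mul_index (powMonoidHom ℓ : G →* G).range
    rw [hind, Nat.gcd_eq_right hcard, ← h1, hker] at h2
    exact (Nat.eq_of_mul_eq_mul_right hℓ.out.pos h2).ge
  exact ⟨hcard, fun x => by rw [heq, MonoidHom.mem_ker]⟩

theorem sum_pow_eq_sum_mul_sum_pow {G : Type*} [CommGroup G] [IsCyclic G] [Fintype G]
    {ℓ : ℕ} [hℓ : Fact ℓ.Prime] {ρ : G →* ℂˣ} (hρ : ρ ^ ℓ = 1) (hρ' : ρ ≠ 1) (h : G → ℂ) :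
    ∑ y, h (y ^ ℓ) = ∑ x, h x * ∑ j ∈ Icc 1 ℓ, (ρ x : ℂ) ^ j := by
  classical
  obtain ⟨hdvd, hrange⟩ := pow_eq_one_iff_mem_range_of_isCyclic hρ hρ'
  rw [← Finset.sum_fiberwise univ (fun y : G => y ^ ℓ)]
  refine Finset.sum_congr rfl fun x _ => ?_
  have h1 : ∑ y with y ^ ℓ = x, h (y ^ ℓ) = #{y : G | y ^ ℓ = x} * h x := by
    rw [← nsmul_eq_mul, ← Finset.sum_const]
    exact Finset.sum_congr rfl fun y hy => by rw [(mem_filter.mp hy).2]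
  rw [h1, mul_comm]
  congr 1
  by_cases hx : ρ x = 1
  · obtain ⟨z, rfl⟩ := (hrange x).mp hx
    have h2 : #{y : G | y ^ ℓ = powMonoidHom ℓ z} = Nat.card (powMonoidHom ℓ : G →* G).ker := by
      refine (MonoidHom.card_fiber_eq_of_mem_range (powMonoidHom ℓ : G →* G) ⟨z, rfl⟩
        ⟨1, rfl⟩).trans ?_
      rw [Nat.card_eq_fintype_card, Fintype.card_subtype]
      refine congrArg Finset.card (Finset.filter_congr fun y _ => ?_)
      rw [MonoidHom.mem_ker, map_one]
    rw [h2, IsCyclic.card_powMonoidHom_ker, Nat.gcd_eq_right hdvd, hx]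
    simp
  · have h2 : #{y : G | y ^ ℓ = x} = 0 := by
      rw [Finset.card_eq_zero, Finset.filter_eq_empty_iff]
      exact fun y _ hy => hx ((hrange x).mpr ⟨y, hy⟩)
    have h3 : (ρ x : ℂ) ^ ℓ = 1 := by
      have := DFunLike.congr_fun hρ x
      rw [MonoidHom.pow_apply] at this
      rw [← Units.val_pow_eq_pow_val, this, MonoidHom.one_apply, Units.val_one]
    have h4 : (ρ x : ℂ) ≠ 1 := by rwa [Ne, Units.val_eq_one]
    rw [h2, ← Finset.Ico_add_one_right_eq_Icc, Finset.sum_Ico_eq_sub _ (by omega),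
      geom_sum_eq h4, pow_succ, h3, Finset.sum_range_one]
    have : (ρ x : ℂ) - 1 ≠ 0 := sub_ne_zero.mpr h4
    field_simp
    simp

end CyclicGroups

section CharacterSums

theorem sum_eq_sum_units {K M : Type*} [Field K] [Fintype K] [Fintype Kˣ] [AddCommMonoid M]
    {h : K → M} (h0 : h 0 = 0) : ∑ x, h x = ∑ x : Kˣ, h x := by
  classical
  rw [Fintype.sum_equiv unitsEquivNeZero (fun x : Kˣ => h x) (fun x => h x) fun _ => rfl,
    ← Finset.sum_subtype (univ.filter (· ≠ 0)) (by simp) h]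
  exact (Finset.sum_filter_of_ne fun x _ hx => by rintro rfl; exact hx h0).symm

variable {F : Type*} [Field F] [Fintype F]

theorem gaussSum'_eq_sum (φ : AddChar F ℂ) (χ : MulChar F ℂ) :
    gaussSum' φ χ = ∑ x, φ x * χ x := by
  classical
  rw [sum_eq_sum_units (by simp [MulChar.map_nonunit])]
  unfold gaussSum'
  refine Fintype.sum_equiv (Equiv.refl _) _ _ fun _ => rfl

end CharacterSums

section NormCoeff

/-- The product of the roots of a monic polynomial, that is, its constant coefficient up to sign. -/
noncomputable def normCoeff {R : Type*} [CommRing R] (f : R[X]) : R :=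
  (-1) ^ f.natDegree * f.coeff 0

theorem normCoeff_one {R : Type*} [CommRing R] : normCoeff (1 : R[X]) = 1 := by
  simp [normCoeff]

theorem normCoeff_mul {R : Type*} [CommRing R] {f g : R[X]} (hf : f.Monic) (hg : g.Monic) :
    normCoeff (f * g) = normCoeff f * normCoeff g := by
  rw [normCoeff, normCoeff, normCoeff, hf.natDegree_mul hg, mul_coeff_zero]
  ring

theorem norm_eq_normCoeff_minpoly_pow {F K : Type*} [Field F] [Field K] [Algebra F K]
    [FiniteDimensional F K] (y : K) :
    Algebra.norm F y = normCoeff (minpoly F y) ^ Module.finrank F⟮y⟯ K := by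
  have hy : IsIntegral F y := .of_finite F y
  have h := Algebra.PowerBasis.norm_gen_eq_coeff_zero_minpoly (adjoin.powerBasis hy)
  rw [← PowerBasis.natDegree_minpoly, adjoin.powerBasis_gen, minpoly_gen] at h
  rw [Algebra.norm_eq_norm_adjoin, h, normCoeff]

end NormCoeff

section LFunction

variable {F : Type*} [Field F] [Finite F] {u : F[X] → ℂ}

/-- The `L`-series of a weight on the monic polynomials over a finite field. -/
noncomputable def monicLSeries (u : F[X] → ℂ) : PowerSeries ℂ :=
  PowerSeries.mk fun n => ∑ f ∈ monicsOfDegree F n, u f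

theorem derivative_monicLSeries (E : ℕ → Type*) [∀ i, Field (E i)] [∀ i, Fintype (E i)]
    [∀ i, Algebra F (E i)] (hE : ∀ i, Module.finrank F (E i) = i + 1) (hu : u 1 = 1)
    (hmul : ∀ f g : F[X], f.Monic → g.Monic → u (f * g) = u f * u g) :
    PowerSeries.derivative ℂ (monicLSeries u) =
      PowerSeries.mk (fun i => ∑ y : E i, u (minpoly F y) ^ Module.finrank F⟮y⟯ (E i)) *
        monicLSeries u := by
  ext n
  rw [PowerSeries.coeff_derivative, PowerSeries.coeff_mul,
    Finset.Nat.sum_antidiagonal_eq_sum_range_succ_mk, mul_comm]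
  simp only [monicLSeries, PowerSeries.coeff_mk]
  exact newton_identity_monicsOfDegree E hE hu hmul n

theorem monicsOfDegree_zero : monicsOfDegree F 0 = {1} := by
  ext f
  rw [mem_monicsOfDegree, mem_singleton]
  exact ⟨fun h => h.1.natDegree_eq_zero.mp h.2, by rintro rfl; simp⟩

theorem constantCoeff_monicLSeries (hu : u 1 = 1) :
    PowerSeries.coeff 0 (monicLSeries u) = 1 := by
  simp [monicLSeries, monicsOfDegree_zero, hu]

end LFunction

section Weights

variable {F : Type*} [Field F]

/-- The weight whose `L`-series is attached to the Gauss sum of an additive and a multiplicative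
character. -/
noncomputable def gaussWeight (φ : AddChar F ℂ) (η : MulChar F ℂ) (f : F[X]) : ℂ :=
  φ (-f.nextCoeff) * η (normCoeff f)

theorem gaussWeight_one (φ : AddChar F ℂ) (η : MulChar F ℂ) : gaussWeight φ η 1 = 1 := by
  simp [gaussWeight, normCoeff_one, nextCoeff]

theorem gaussWeight_mul (φ : AddChar F ℂ) (η : MulChar F ℂ) {f g : F[X]} (hf : f.Monic)
    (hg : g.Monic) : gaussWeight φ η (f * g) = gaussWeight φ η f * gaussWeight φ η g := by
  rw [gaussWeight, hf.nextCoeff_mul hg, normCoeff_mul hf hg, neg_add, AddChar.map_add_eq_mul,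
    map_mul, gaussWeight, gaussWeight]
  ring

theorem gaussWeight_minpoly_pow {K : Type*} [Field K] [Algebra F K] [FiniteDimensional F K]
    (φ : AddChar F ℂ) (η : MulChar F ℂ) (y : K) :
    gaussWeight φ η (minpoly F y) ^ Module.finrank F⟮y⟯ K =
      φ (Algebra.trace F K y) * η (Algebra.norm F y) := by
  rw [gaussWeight, mul_pow, ← AddChar.map_nsmul_eq_pow, ← map_pow,
    ← norm_eq_normCoeff_minpoly_pow, trace_eq_finrank_mul_minpoly_nextCoeff, nsmul_eq_mul]

/-- The weight attached to a sum of values of characters at fifth powers. -/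
noncomputable def gaussWeightPowFive (φ : AddChar F ℂ) (η : MulChar F ℂ) (f : F[X]) : ℂ :=
  φ (fifthPowerSum f) * η (normCoeff f) ^ 5

theorem gaussWeightPowFive_one (φ : AddChar F ℂ) (η : MulChar F ℂ) :
    gaussWeightPowFive φ η 1 = 1 := by
  simp [gaussWeightPowFive, normCoeff_one, fifthPowerSum_one]

theorem gaussWeightPowFive_mul (φ : AddChar F ℂ) (η : MulChar F ℂ) {f g : F[X]} (hf : f.Monic)
    (hg : g.Monic) : gaussWeightPowFive φ η (f * g) =
      gaussWeightPowFive φ η f * gaussWeightPowFive φ η g := by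
  rw [gaussWeightPowFive, fifthPowerSum_mul hf hg, normCoeff_mul hf hg, AddChar.map_add_eq_mul,
    map_mul, gaussWeightPowFive, gaussWeightPowFive]
  ring

theorem gaussWeightPowFive_minpoly_pow [Finite F] {K : Type*} [Field K] [Finite K] [Algebra F K]
    (φ : AddChar F ℂ) (η : MulChar F ℂ) (y : K) :
    gaussWeightPowFive φ η (minpoly F y) ^ Module.finrank F⟮y⟯ K =
      φ (Algebra.trace F K (y ^ 5)) * η (Algebra.norm F (y ^ 5)) := by
  rw [gaussWeightPowFive, mul_pow, ← AddChar.map_nsmul_eq_pow, ← pow_mul, mul_comm 5, pow_mul,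
    ← map_pow, ← norm_eq_normCoeff_minpoly_pow, trace_pow_five_eq, map_pow, map_pow]

end Weights

section CharacterSums

variable {F : Type*} [Field F]

/-- Summing a character sum over fifth powers amounts to twisting by the characters of order
dividing `5`. -/
theorem sum_trace_norm_pow_five {K : Type*} [Field K] [Fintype K] [Algebra F K]
    (φ : AddChar F ℂ) {χ : MulChar F ℂ} (hχ : orderOf χ = 5) (η : MulChar F ℂ) :
    ∑ y : K, φ (Algebra.trace F K (y ^ 5)) * η (Algebra.norm F (y ^ 5)) =
      ∑ j ∈ Icc 1 5, ∑ y : K, φ (Algebra.trace F K y) * (χ ^ j * η) (Algebra.norm F y) := by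
  classical
  have : Finite F := Finite.of_injective _ (algebraMap F K).injective
  have : Fact (Nat.Prime 5) := ⟨by norm_num⟩
  have hzero (θ : MulChar F ℂ) : φ (Algebra.trace F K 0) * θ (Algebra.norm F (0 : K)) = 0 := by
    rw [Algebra.norm_zero, MulChar.map_zero, mul_zero]
  let ρ : Kˣ →* ℂˣ := χ.toUnitHom.comp (Units.map (Algebra.norm F))
  have hval (x : Kˣ) : (ρ x : ℂ) = χ (Algebra.norm F (x : K)) := by
    simp [ρ]
  have hρ : ρ ^ 5 = 1 := by
    ext x
    have hx : IsUnit (Algebra.norm F (x : K)) := x.isUnit.map _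
    rw [MonoidHom.pow_apply, Units.val_pow_eq_pow_val, hval, ← MulChar.pow_apply' _ (by norm_num),
      ← hχ, pow_orderOf_eq_one, MulChar.one_apply hx, MonoidHom.one_apply, Units.val_one]
  have hρ' : ρ ≠ 1 := by
    intro h
    have h1 : χ = 1 := by
      ext a
      obtain ⟨x, rfl⟩ := FiniteField.unitsMap_norm_surjective F K a
      have := hval x
      rw [h, MonoidHom.one_apply, Units.val_one, eq_comm] at this
      rw [MulChar.one_apply_coe]
      simpa using this
    rw [h1, orderOf_one] at hχ
    norm_num at hχ
  rw [sum_eq_sum_units (by simpa using hzero η)]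
  have h := sum_pow_eq_sum_mul_sum_pow hρ hρ'
    fun y : Kˣ => φ (Algebra.trace F K y) * η (Algebra.norm F (y : K))
  simp only [Units.val_pow_eq_pow_val] at h
  rw [h, Finset.sum_congr rfl fun j _ => sum_eq_sum_units (hzero (χ ^ j * η)), Finset.sum_comm]
  refine Finset.sum_congr rfl fun x _ => ?_
  rw [Finset.mul_sum]
  refine Finset.sum_congr rfl fun j hj => ?_
  rw [hval, MulChar.mul_apply, MulChar.pow_apply' _ (by grind)]
  ring

end CharacterSums

section GaussSumLSeries

variable {F : Type*} [Field F] [Fintype F]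

theorem sum_monicsOfDegree_one {M : Type*} [AddCommMonoid M] (w : F[X] → M) :
    ∑ f ∈ monicsOfDegree F 1, w f = ∑ r, w (X - C r) := by
  refine Finset.sum_bij' (fun f _ => -f.coeff 0) (fun r _ => X - C r) (by simp) ?_ ?_ ?_ ?_
  · exact fun r _ => mem_monicsOfDegree.mpr ⟨monic_X_sub_C r, natDegree_X_sub_C r⟩
  · intro f hf
    rw [mem_monicsOfDegree] at hf
    conv_rhs => rw [hf.1.eq_X_add_C hf.2]
    simp
  · simp
  · intro f hf
    rw [mem_monicsOfDegree] at hf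
    conv_lhs => rw [hf.1.eq_X_add_C hf.2]
    simp

theorem sum_monicsOfDegree_one_gaussWeight (φ : AddChar F ℂ) (η : MulChar F ℂ) :
    ∑ f ∈ monicsOfDegree F 1, gaussWeight φ η f = gaussSum' φ η := by
  rw [sum_monicsOfDegree_one, gaussSum'_eq_sum]
  refine Finset.sum_congr rfl fun r _ => ?_
  simp [gaussWeight, normCoeff, nextCoeff_X_sub_C]

theorem sum_monicsOfDegree_gaussWeight_eq_zero {φ : AddChar F ℂ} (hφ : φ ≠ 1) (η : MulChar F ℂ)
    (n : ℕ) : ∑ f ∈ monicsOfDegree F (n + 2), gaussWeight φ η f = 0 := by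
  obtain ⟨c, hc⟩ := AddChar.ne_one_iff.mp hφ
  have hlt (c : F) {f : F[X]} (hf : f.natDegree = n + 2) :
      (C c * X ^ (n + 1)).natDegree < f.natDegree := by
    have := natDegree_C_mul_X_pow_le c (n + 1)
    omega
  have hmem (c : F) {f : F[X]} (hf : f ∈ monicsOfDegree F (n + 2)) :
      f + C c * X ^ (n + 1) ∈ monicsOfDegree F (n + 2) := by
    rw [mem_monicsOfDegree] at hf ⊢
    refine ⟨hf.1.add_of_left ?_, ?_⟩
    · exact degree_lt_degree (hlt c hf.2)
    · rw [natDegree_add_eq_left_of_natDegree_lt (hlt c hf.2), hf.2]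
  have h : ∑ f ∈ monicsOfDegree F (n + 2), gaussWeight φ η f =
      φ c * ∑ f ∈ monicsOfDegree F (n + 2), gaussWeight φ η f := by
    rw [Finset.mul_sum]
    refine Finset.sum_bij' (fun f _ => f + C c * X ^ (n + 1)) (fun f _ => f + C (-c) * X ^ (n + 1))
      (fun f hf => hmem c hf) (fun f hf => hmem (-c) hf) (by simp) (by simp) ?_
    intro f hf
    have hf' := (mem_monicsOfDegree.mp (hmem c hf)).2
    rw [mem_monicsOfDegree] at hf
    rw [gaussWeight, gaussWeight, normCoeff, normCoeff, hf', hf.2,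
      nextCoeff_of_natDegree_pos (by omega), nextCoeff_of_natDegree_pos (by omega), hf', hf.2,
      ← mul_assoc, ← AddChar.map_add_eq_mul]
    simp
  by_contra h0
  exact hc (mul_eq_right₀ h0 |>.mp h.symm)

theorem monicLSeries_gaussWeight {φ : AddChar F ℂ} (hφ : φ ≠ 1) (η : MulChar F ℂ) :
    monicLSeries (gaussWeight φ η) = ((1 + C (gaussSum' φ η) * X : ℂ[X]) : PowerSeries ℂ) := by
  ext n
  rw [Polynomial.coeff_coe, monicLSeries, PowerSeries.coeff_mk]
  rcases n with _ | _ | n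
  · simp [monicsOfDegree_zero, gaussWeight_one]
  · simp [sum_monicsOfDegree_one_gaussWeight, coeff_one]
  · rw [sum_monicsOfDegree_gaussWeight_eq_zero hφ]
    simp [coeff_one]

theorem monicLSeries_gaussWeightPowFive (φ : AddChar F ℂ) {χ : MulChar F ℂ} (hχ : orderOf χ = 5)
    (η : MulChar F ℂ) :
    monicLSeries (gaussWeightPowFive φ η) =
      ∏ j ∈ Icc 1 5, monicLSeries (gaussWeight φ (χ ^ j * η)) := by
  have : Fact (ringChar F).Prime := ⟨CharP.char_is_prime F _⟩
  let E (i : ℕ) := FiniteField.Extension F (ringChar F) (i + 1)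
  have (i : ℕ) : Fintype (E i) := Fintype.ofFinite _
  have hE (i : ℕ) : Module.finrank F (E i) = i + 1 := FiniteField.finrank_extension ..
  refine PowerSeries.eq_of_derivative_eq_mul (derivative_monicLSeries E hE
    (gaussWeightPowFive_one φ η) fun f g => gaussWeightPowFive_mul φ η) ?_ ?_
  · rw [PowerSeries.derivative_prod_eq_sum_mul _ fun j _ => derivative_monicLSeries E hE
      (gaussWeight_one φ (χ ^ j * η)) fun f g => gaussWeight_mul φ _]
    congr 1
    ext i
    simp only [map_sum, PowerSeries.coeff_mk, gaussWeightPowFive_minpoly_pow,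
      gaussWeight_minpoly_pow]
    exact (sum_trace_norm_pow_five φ hχ η).symm
  · rw [constantCoeff_monicLSeries (gaussWeightPowFive_one φ η),
      PowerSeries.coeff_zero_eq_constantCoeff_apply, map_prod]
    refine (Finset.prod_eq_one fun j _ => ?_).symm
    rw [← PowerSeries.coeff_zero_eq_constantCoeff_apply,
      constantCoeff_monicLSeries (gaussWeight_one φ _)]

theorem sum_monicsOfDegree_five_gaussWeightPowFive {φ : AddChar F ℂ} (hφ : φ ≠ 1)
    {χ : MulChar F ℂ} (hχ : orderOf χ = 5) (η : MulChar F ℂ) :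
    ∑ f ∈ monicsOfDegree F 5, gaussWeightPowFive φ η f =
      ∏ j ∈ Icc 1 5, gaussSum' φ (χ ^ j * η) := by
  have h := congrArg (PowerSeries.coeff 5) (monicLSeries_gaussWeightPowFive φ hχ η)
  simp only [monicLSeries_gaussWeight hφ] at h
  rw [monicLSeries, PowerSeries.coeff_mk] at h
  have hdeg (G : ℂ) : (1 + C G * X).natDegree ≤ 1 := by compute_degree
  have hprod := coeff_prod_of_natDegree_le (Icc 1 5)
    (fun j => 1 + C (gaussSum' φ (χ ^ j * η)) * X) 1 fun j _ => hdeg _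
  simp only [← Polynomial.coeToPowerSeries.ringHom_apply, ← map_prod] at h
  rw [h, coeToPowerSeries.ringHom_apply, Polynomial.coeff_coe]
  simpa [coeff_one] using hprod

end GaussSumLSeries

section Quintics

variable {F : Type*} [Field F] [Fintype F]

theorem eq_of_mem_monicsOfDegree_five {f : F[X]} (hf : f ∈ monicsOfDegree F 5) :
    f = X ^ 5 + C (f.coeff 4) * X ^ 4 + C (f.coeff 3) * X ^ 3 + C (f.coeff 2) * X ^ 2 +
      C (f.coeff 1) * X + C (f.coeff 0) := by
  rw [mem_monicsOfDegree] at hf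
  have h := f.as_sum_range_C_mul_X_pow
  have h5 : f.coeff 5 = 1 := hf.2 ▸ hf.1.coeff_natDegree
  simp only [hf.2, Finset.sum_range_succ, Finset.sum_range_zero, h5, map_one, pow_zero,
    pow_one] at h
  conv_lhs => rw [h]
  ring

theorem sum_monicsOfDegree_five {M : Type*} [AddCommMonoid M] (w : F[X] → M) :
    ∑ f ∈ monicsOfDegree F 5, w f = ∑ a, ∑ b, ∑ e, ∑ c, ∑ d,
      w (X ^ 5 + C a * X ^ 4 + C b * X ^ 3 + C c * X ^ 2 + C d * X + C e) := by
  simp only [← Fintype.sum_prod_type']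
  refine Finset.sum_bij' (fun f _ => (f.coeff 4, f.coeff 3, f.coeff 0, f.coeff 2, f.coeff 1))
    (fun t _ => X ^ 5 + C t.1 * X ^ 4 + C t.2.1 * X ^ 3 + C t.2.2.2.1 * X ^ 2 +
      C t.2.2.2.2 * X + C t.2.2.1) (by simp) ?_ ?_ ?_ ?_
  · exact fun t _ => mem_monicsOfDegree.mpr ⟨by monicity!, by compute_degree!⟩
  · exact fun f hf => (eq_of_mem_monicsOfDegree_five hf).symm
  · intro t _
    simp [coeff_X, coeff_C]
  · exact fun f hf => congrArg w (eq_of_mem_monicsOfDegree_five hf)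

theorem sum_monicsOfDegree_five_gaussWeightPowFive_eq_mul_gaussSum' (h5 : (5 : F) ≠ 0)
    {φ : AddChar F ℂ} (hφ : φ ≠ 1) (η : MulChar F ℂ) :
    ∑ f ∈ monicsOfDegree F 5, gaussWeightPowFive φ η f =
      (Fintype.card F : ℂ) ^ 2 * η (5⁻¹ ^ 5) * gaussSum' φ (η ^ 5) := by
  classical
  have hw (a b c d e : F) : gaussWeightPowFive φ η
      (X ^ 5 + C a * X ^ 4 + C b * X ^ 3 + C c * X ^ 2 + C d * X + C e) =
      φ (5 * a ^ 3 * b - a ^ 5 - 5 * a * b ^ 2 - 5 * e) * η (-e) ^ 5 *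
        (φ (c * (5 * (b - a ^ 2))) * φ (d * (5 * a))) := by
    set f : F[X] := X ^ 5 + C a * X ^ 4 + C b * X ^ 3 + C c * X ^ 2 + C d * X + C e with hf
    have hdeg : f.natDegree = 5 := by
      rw [hf]
      compute_degree!
    have hc (i : ℕ) (hi : i ≤ 5) : f.reverse.coeff i = f.coeff (5 - i) := by
      rw [coeff_reverse, hdeg, revAt_le hi]
    have hcoeff : f.coeff 4 = a ∧ f.coeff 3 = b ∧ f.coeff 2 = c ∧ f.coeff 1 = d ∧ f.coeff 0 = e := by
      simp [hf, coeff_X, coeff_C]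
    obtain ⟨h4, h3, h2, h1, h0⟩ := hcoeff
    rw [gaussWeightPowFive, fifthPowerSum, normCoeff, hdeg, hc 1 (by norm_num),
      hc 2 (by norm_num), hc 3 (by norm_num), hc 4 (by norm_num), hc 5 (by norm_num), h4, h3, h2,
      h1, h0, ← AddChar.map_add_eq_mul, mul_right_comm (φ _), ← AddChar.map_add_eq_mul]
    congr 2 <;> ring_nf
  have hsum (t : F) : ∑ x, φ (x * (5 * t)) = if t = 0 then (Fintype.card F : ℂ) else 0 := by
    rw [AddChar.sum_mulShift _ (.of_ne_one hφ)]
    simp [h5]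
  simp only [sum_monicsOfDegree_five, hw, ← Finset.mul_sum, ← Finset.sum_mul, hsum]
  rw [Finset.sum_eq_single 0 (by simp +contextual) (by simp),
    Finset.sum_eq_single 0 (by simp +contextual) (by simp)]
  have h5' : (-5 : F) ≠ 0 := neg_ne_zero.mpr h5
  rw [gaussSum'_eq_sum, ← Equiv.sum_comp (Equiv.mulLeft₀ (-5) h5') fun x => φ x * (η ^ 5) x,
    Finset.mul_sum, Finset.sum_mul]
  refine Finset.sum_congr rfl fun e _ => ?_
  have hη : η (5⁻¹ ^ 5) * η (-5 * e) ^ 5 = η (-e) ^ 5 := by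
    rw [← map_pow, ← map_pow, ← map_mul, ← mul_pow]
    congr 2
    field_simp
  rw [MulChar.pow_apply' _ (by norm_num), Equiv.mulLeft₀_apply, ← hη]
  simp
  ring

end Quintics

/-- The Hasse-Davenport product formula for the characters of order dividing `5`. -/
theorem prod_gaussSum'_eq {F : Type*} [Field F] [Fintype F] (h5 : (5 : F) ≠ 0)
    {φ : AddChar F ℂ} (hφ : φ ≠ 1) {χ : MulChar F ℂ} (hχ : orderOf χ = 5) (η : MulChar F ℂ) :
    ∏ j ∈ Icc 1 5, gaussSum' φ (χ ^ j * η) =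
      (Fintype.card F : ℂ) ^ 2 * η (5⁻¹ ^ 5) * gaussSum' φ (η ^ 5) := by
  rw [← sum_monicsOfDegree_five_gaussWeightPowFive hφ hχ,
    sum_monicsOfDegree_five_gaussWeightPowFive_eq_mul_gaussSum' h5 hφ]

end HasseDavenport

/-- Let `F` be a finite field with `q ≡ 1 (mod 5)` elements of
characteristic `p ≠ 5`, let `ψ ∈ F*`, let `χ` be a multiplicative character of `F` of
order `5`, and let `(s₁,…,s₅)` be a 5-tuple of integers. Then
`N_{(s₁,…,s₅),χ}(q) = (1/(q-1)) ∑_η q^{3-z-δ} (∏_{j=1}^{5} G(φ,χ^j η)) /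
(∏_{j=1}^{5} G(φ,χ^{s_j} η)) · η(1/ψ⁵)`. -/
theorem stmt_15 {F : Type*} [Field F] [Fintype F] (hchar : ringChar F ≠ 5)
    (hq : Fintype.card F % 5 = 1) (ψ : F) (hψ : ψ ≠ 0)
    (φ : AddChar F ℂ) (hφ : φ ≠ 1) (χ : MulChar F ℂ) (hχ : orderOf χ = 5)
    (s : Fin 5 → ℤ) :
    Ntuple φ χ ψ s =
      (1 / ((Fintype.card F : ℂ) - 1)) *
        ∑ η : MulChar F ℂ,
          (Fintype.card F : ℂ) ^ ((3 : ℤ) - zNum χ η s - deltaNum χ η s) *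
            (∏ j ∈ Finset.Icc (1 : ℕ) 5, gaussSum' φ (χ ^ j * η)) /
            (∏ j : Fin 5, gaussSum' φ (χ ^ s j * η)) * η ((ψ ^ 5)⁻¹) := by
  have h5 : (5 : F) ≠ 0 := by
    intro h
    have hdvd : ringChar F ∣ 5 := (ringChar.spec F 5).mp (by exact_mod_cast h)
    exact ((Nat.dvd_prime Nat.prime_five).mp hdvd).elim CharP.ringChar_ne_one hchar
  have hcard : (Fintype.card F : ℂ) ≠ 0 := Nat.cast_ne_zero.mpr Fintype.card_ne_zero
  rw [Ntuple]
  congr 1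
  refine Finset.sum_congr rfl fun η _ => ?_
  have hpow : (Fintype.card F : ℂ) ^ ((5 : ℤ) - zNum χ η s - deltaNum χ η s) =
      (Fintype.card F : ℂ) ^ 2 *
        (Fintype.card F : ℂ) ^ ((3 : ℤ) - zNum χ η s - deltaNum χ η s) := by
    rw [← zpow_natCast, ← zpow_add₀ hcard]
    congr 1
    push_cast
    ring
  rw [prod_gaussSum'_eq h5 hφ hχ, hpow, mul_pow, mul_inv, map_mul, inv_pow]
  ring
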